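/- Assume the mechanical setting. Then for every smooth f : ℝⁿ × ℝⁿ × ℝ → ℝ and every x ∈ M×ℝ, {H, f}_E(x) = {H, f∘Γ}(x); that is, the contact Eden bracket {H∘Γ, f∘Γ} agrees at points of M×ℝ with the unconstrained contact bracket of H with f∘Γ. -/

import Mathlib

open scoped BigOperators Matrix
noncomputable section

/-- Phase space `ℝⁿ × ℝⁿ × ℝ`, modeling `T*Q × ℝ` for `Q = ℝⁿ`. -/
abbrev PS (n : ℕ) := (Fin n → ℝ) × (Fin n → ℝ) × ℝ

/-- Partial derivative in the `qⁱ` direction. -/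
def pdq {n : ℕ} (F : PS n → ℝ) (x : PS n) (i : Fin n) : ℝ :=
  fderiv ℝ F x (Pi.single i 1, 0, 0)

/-- Partial derivative in the `pᵢ` direction. -/
def pdp {n : ℕ} (F : PS n → ℝ) (x : PS n) (i : Fin n) : ℝ :=
  fderiv ℝ F x (0, Pi.single i 1, 0)

/-- Partial derivative in the `z` direction. -/
def pdz {n : ℕ} (F : PS n → ℝ) (x : PS n) : ℝ :=
  fderiv ℝ F x (0, 0, 1)

/-- The flat map `♭ₓ(v) = ι_v dη + η(v) η` at `x = (q,p,z)`, for `η = dz − Σ pᵢ dqⁱ`;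
covectors are identified with triples (dq-components, dp-components, dz-component). -/
def flatMap {n : ℕ} (x : PS n) (v : PS n) : PS n :=
  (fun i => -v.2.1 i - (v.2.2 - ∑ j, x.2.1 j * v.1 j) * x.2.1 i,
   v.1,
   v.2.2 - ∑ j, x.2.1 j * v.1 j)

/-- The contact Hamiltonian vector field of `F`. -/
def XH {n : ℕ} (F : PS n → ℝ) (x : PS n) : PS n :=
  (fun i => pdp F x i,
   fun i => -pdq F x i - x.2.1 i * pdz F x,
   (∑ i, x.2.1 i * pdp F x i) - F x)

/-- The contact (Jacobi) bracket. -/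
def jacB {n : ℕ} (f g : PS n → ℝ) (x : PS n) : ℝ :=
  (∑ i, (pdp f x i * pdq g x i - pdp g x i * pdq f x i))
  + (∑ i, x.2.1 i * (pdp f x i * pdz g x - pdp g x i * pdz f x))
  + g x * pdz f x - f x * pdz g x

/-- The differential of `F` at `x`, as a covector triple. -/
def dCov {n : ℕ} (F : PS n → ℝ) (x : PS n) : PS n :=
  (fun i => pdq F x i, fun i => pdp F x i, pdz F x)

/-- The contact form `η = dz − Σ pᵢ dqⁱ` at `x`, as a covector triple. -/
def etaCov {n : ℕ} (x : PS n) : PS n :=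
  (fun i => -x.2.1 i, 0, 1)

/-- The mechanical setting: a smooth Riemannian metric `G` on `ℝⁿ`, a smooth potential `V`,
and a smooth fiberwise projection `P` (idempotent, `G⁻¹`-symmetric) onto the constraint
subbundle along the annihilator of the constraint distribution. -/
structure MechSetting (n : ℕ) where
  hn : 1 ≤ n
  G : (Fin n → ℝ) → Matrix (Fin n) (Fin n) ℝ
  V : (Fin n → ℝ) × ℝ → ℝ
  P : (Fin n → ℝ) → Matrix (Fin n) (Fin n) ℝ
  G_smooth : ∀ i j, ContDiff ℝ (⊤ : ℕ∞) (fun q => G q i j)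
  G_symm : ∀ q, (G q).IsSymm
  G_posdef : ∀ q, (G q).PosDef
  V_smooth : ContDiff ℝ (⊤ : ℕ∞) V
  P_smooth : ∀ i j, ContDiff ℝ (⊤ : ℕ∞) (fun q => P q i j)
  P_proj : ∀ q, P q * P q = P q
  P_symm : ∀ q, (P q)ᵀ * (G q)⁻¹ = (G q)⁻¹ * P q

namespace MechSetting

variable {n : ℕ} (S : MechSetting n)

/-- The mechanical Hamiltonian `H(q,p,z) = ½ pᵀ G(q)⁻¹ p + V(q,z)`. -/
def H (x : PS n) : ℝ :=
  (1 / 2) * (∑ i, ∑ j, x.2.1 i * (S.G x.1)⁻¹ i j * x.2.1 j) + S.V (x.1, x.2.2)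

/-- The projection `Γ(q,p,z) = (q, P(q)p, z)` onto `M×ℝ`. -/
def Gam (x : PS n) : PS n :=
  (x.1, (S.P x.1).mulVec x.2.1, x.2.2)

/-- Membership in the constraint submanifold `M×ℝ = {(q,p,z) : P(q)p = p}`. -/
def onM (x : PS n) : Prop :=
  (S.P x.1).mulVec x.2.1 = x.2.1

/-- The constraint distribution `D(q) = {G(q)⁻¹ m : P(q) m = m}`. -/
def Dd (q : Fin n → ℝ) : Set (Fin n → ℝ) :=
  {v | ∃ m, (S.P q).mulVec m = m ∧ v = ((S.G q)⁻¹).mulVec m}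

/-- Entrywise partial derivative `∂P/∂qⁱ` of the matrix-valued map `P`. -/
def dP (q : Fin n → ℝ) (i : Fin n) : Matrix (Fin n) (Fin n) ℝ :=
  fun j k => fderiv ℝ (fun q' => S.P q' j k) q (Pi.single i 1)

end MechSetting

/-- The annihilator `D° = {α ∈ ℝⁿ : Σᵢ αᵢ vᵢ = 0 for all v ∈ D}` of a subspace `D ⊆ ℝⁿ`. -/
def annih {n : ℕ} (D : Submodule ℝ (Fin n → ℝ)) : Submodule ℝ (Fin n → ℝ) where
  carrier := {α | ∀ v ∈ D, ∑ i, α i * v i = 0}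
  zero_mem' := by intro v hv; simp
  add_mem' := by
    intro a b ha hb v hv
    have h1 := ha v hv
    have h2 := hb v hv
    simp only [Pi.add_apply, add_mul, Finset.sum_add_distrib, h1, h2, add_zero]
  smul_mem' := by
    intro c a ha v hv
    simp only [Pi.smul_apply, smul_eq_mul, mul_assoc, ← Finset.mul_sum, ha v hv, mul_zero]

theorem Matrix.differentiable_det {E m : Type*} [NormedAddCommGroup E] [NormedSpace ℝ E]
    [Fintype m] [DecidableEq m] {A : E → Matrix m m ℝ}
    (hA : ∀ i j, Differentiable ℝ fun x => A x i j) :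
    Differentiable ℝ fun x => (A x).det := by
  simp only [Matrix.det_apply']
  exact Differentiable.fun_sum fun σ _ =>
    Differentiable.const_mul (by fun_prop) _

theorem Matrix.differentiable_inv_apply {E m : Type*} [NormedAddCommGroup E] [NormedSpace ℝ E]
    [Fintype m] [DecidableEq m] {A : E → Matrix m m ℝ}
    (hA : ∀ i j, Differentiable ℝ fun x => A x i j) (hdet : ∀ x, (A x).det ≠ 0) (i j : m) :
    Differentiable ℝ fun x => (A x)⁻¹ i j := by
  simp only [Matrix.inv_def, Ring.inverse_eq_inv', Matrix.smul_apply, smul_eq_mul,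
    Matrix.adjugate_apply]
  refine ((Matrix.differentiable_det hA).inv hdet).mul (Matrix.differentiable_det fun k l => ?_)
  by_cases h : k = j
  · subst h
    simp
  · simpa [Matrix.updateRow_apply, h] using hA k l

/-- The kinetic energy of the component of the momentum removed by the projection. -/
def MechSetting.normalEnergy {n : ℕ} (S : MechSetting n) (x : PS n) : ℝ :=
  (1 / 2) * ((x.2.1 - (S.P x.1).mulVec x.2.1) ⬝ᵥ
    ((S.G x.1)⁻¹.mulVec (x.2.1 - (S.P x.1).mulVec x.2.1)))

namespace MechSetting

theorem H_eq_dotProduct {n : ℕ} (S : MechSetting n) (x : PS n) :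
    S.H x = (1 / 2) * (x.2.1 ⬝ᵥ ((S.G x.1)⁻¹.mulVec x.2.1)) + S.V (x.1, x.2.2) := by
  simp only [H, dotProduct, Matrix.mulVec, Finset.mul_sum, mul_assoc]

theorem H_Gam {n : ℕ} (S : MechSetting n) (x : PS n) :
    S.H (S.Gam x) = S.H x - S.normalEnergy x := by
  obtain ⟨q, p, z⟩ := x
  have key : ∀ u : Fin n → ℝ, (S.P q).mulVec p ⬝ᵥ ((S.G q)⁻¹.mulVec u)
      = p ⬝ᵥ ((S.G q)⁻¹ * S.P q).mulVec u := by
    intro u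
    rw [← S.P_symm q, ← Matrix.mulVec_mulVec, Matrix.dotProduct_mulVec p, Matrix.vecMul_transpose]
  simp only [H_eq_dotProduct, Gam, normalEnergy, Matrix.mulVec_sub, dotProduct_sub,
    sub_dotProduct, key]
  simp only [Matrix.mulVec_mulVec, Matrix.mul_assoc, S.P_proj q]
  ring

theorem normalEnergy_nonneg {n : ℕ} (S : MechSetting n) (x : PS n) : 0 ≤ S.normalEnergy x := by
  have h := (S.G_posdef x.1).inv.posSemidef.dotProduct_mulVec_nonneg
    (x.2.1 - (S.P x.1).mulVec x.2.1)
  rw [star_trivial] at h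
  exact mul_nonneg (by norm_num) h

theorem differentiable_inv_G_apply {n : ℕ} (S : MechSetting n) (i j : Fin n) :
    Differentiable ℝ fun q => (S.G q)⁻¹ i j :=
  Matrix.differentiable_inv_apply (fun k l => (S.G_smooth k l).differentiable (by simp))
    (fun q => (S.G_posdef q).det_pos.ne') i j

theorem differentiable_H {n : ℕ} (S : MechSetting n) : Differentiable ℝ S.H := by
  have hG (i j : Fin n) : Differentiable ℝ fun x : PS n => (S.G x.1)⁻¹ i j :=
    (S.differentiable_inv_G_apply i j).comp differentiable_fst
  have hV : Differentiable ℝ fun x : PS n => S.V (x.1, x.2.2) :=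
    (S.V_smooth.differentiable (by simp)).comp (by fun_prop)
  have hp (i : Fin n) : Differentiable ℝ fun x : PS n => x.2.1 i := by fun_prop
  exact ((Differentiable.fun_sum fun i _ => Differentiable.fun_sum fun j _ =>
    ((hp i).mul (hG i j)).mul (hp j)).const_mul _).add hV

theorem differentiable_Gam {n : ℕ} (S : MechSetting n) : Differentiable ℝ S.Gam := by
  have hP (i j : Fin n) : Differentiable ℝ fun x : PS n => S.P x.1 i j :=
    ((S.P_smooth i j).differentiable (by simp)).comp differentiable_fst
  unfold Gam Matrix.mulVec dotProduct
  fun_prop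

/-- Since `H ∘ Γ ≤ H` with equality on the constraint submanifold, the two functions have the
same differential there. -/
theorem fderiv_H_comp_Gam {n : ℕ} (S : MechSetting n) {x : PS n} (hx : S.onM x) :
    fderiv ℝ (S.H ∘ S.Gam) x = fderiv ℝ S.H x := by
  have hmin : IsLocalMin (S.H - S.H ∘ S.Gam) x := by
    refine Filter.Eventually.of_forall fun y => ?_
    have hGam : S.Gam x = x := by
      rw [Gam, hx]
    simp only [Pi.sub_apply, Function.comp_apply, hGam, sub_self, S.H_Gam y, sub_sub_cancel]
    exact S.normalEnergy_nonneg y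
  have h := hmin.fderiv_eq_zero
  rw [fderiv_sub (S.differentiable_H x)
    ((S.differentiable_H.comp S.differentiable_Gam) x), sub_eq_zero] at h
  exact h.symm

end MechSetting

/-- `{H, f}_E = {H, f∘Γ}` on `M×ℝ`. -/
theorem statement_15 {n : ℕ} (S : MechSetting n)
    (f : PS n → ℝ) (hf : ContDiff ℝ (⊤ : ℕ∞) f) (x : PS n) (hx : S.onM x) :
    jacB (S.H ∘ S.Gam) (f ∘ S.Gam) x = jacB S.H (f ∘ S.Gam) x := by
  have hGam : S.Gam x = x := by
    rw [MechSetting.Gam, hx]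
  simp only [jacB, pdq, pdp, pdz, S.fderiv_H_comp_Gam hx, Function.comp_apply, hGam]
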